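/- Let Γ = ⟨S | R⟩ be a finitely presented group and let 𝒞 be a family of groups with bi-invariant metrics such that each (G, d) ∈ 𝒞 is a complete metric space. If Γ has the property of defect diminishing with respect to 𝒞, then Γ is 𝒞-stable. -/

import Mathlib

/-- A group equipped with a bi-invariant metric. -/
structure MetricGroup where
  carrier : Type
  [group : Group carrier]
  [metric : MetricSpace carrier]
  dist_left_invariant : ∀ g x y : carrier, dist (g * x) (g * y) = dist x y
  dist_right_invariant : ∀ g x y : carrier, dist (x * g) (y * g) = dist x y

attribute [instance] MetricGroup.group MetricGroup.metric

/-- defect(φ) = max_{r ∈ R} d(φ(r), 1), where φ also denotes the induced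
homomorphism F(S) → G. -/
noncomputable def defect {S : Type} [Fintype S] (R : Finset (FreeGroup S)) {G : MetricGroup}
    (φ : S → G.carrier) : ℝ :=
  ((R.sup fun r => nndist ((FreeGroup.lift φ) r) 1 : NNReal) : ℝ)

/-- dist(φ, ψ) = max_{s ∈ S} d(φ(s), ψ(s)). -/
noncomputable def mapDist {S : Type} [Fintype S] {G : MetricGroup} (φ ψ : S → G.carrier) : ℝ :=
  ((Finset.univ.sup fun s => nndist (φ s) (ψ s) : NNReal) : ℝ)

/-- HomDist(φ) = inf over homomorphisms π : Γ → G of dist(φ, (π ∘ q)|_S),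
where Γ = F(S)/⟨⟨R⟩⟩ and q is the quotient map. -/
noncomputable def homDist {S : Type} [Fintype S] (R : Finset (FreeGroup S)) {G : MetricGroup}
    (φ : S → G.carrier) : ℝ :=
  ⨅ π : (FreeGroup S ⧸ Subgroup.normalClosure (R : Set (FreeGroup S))) →* G.carrier,
    mapDist φ (fun s => π ((QuotientGroup.mk' _) (FreeGroup.of s)))

/-- A sequence of maps φₙ : S → Gₙ is an asymptotic homomorphism if
lim_{n→𝒰} defect(φₙ) = 0. -/
def IsAsymptoticHom {S : Type} [Fintype S] (𝒰 : Ultrafilter ℕ) (R : Finset (FreeGroup S))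
    (G : ℕ → MetricGroup) (φ : ∀ n, S → (G n).carrier) : Prop :=
  Filter.Tendsto (fun n => defect R (φ n)) (𝒰 : Filter ℕ) (nhds 0)

/-- φ' diminishes the defect of φ: (a) dist(φₙ, φ'ₙ) = O_𝒰(defect(φₙ)) and
(b) defect(φ'ₙ) = o_𝒰(defect(φₙ)). -/
def Diminishes {S : Type} [Fintype S] (𝒰 : Ultrafilter ℕ) (R : Finset (FreeGroup S))
    (G : ℕ → MetricGroup) (φ φ' : ∀ n, S → (G n).carrier) : Prop :=
  (∃ C : ℝ, 0 < C ∧ {n | mapDist (φ n) (φ' n) ≤ C * defect R (φ n)} ∈ 𝒰) ∧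
  (∃ ε : ℕ → ℝ, (∀ n, 0 ≤ ε n) ∧ Filter.Tendsto ε (𝒰 : Filter ℕ) (nhds 0) ∧
     ∀ n, defect R (φ' n) = ε n * defect R (φ n))

/-- The property of defect diminishing for the presentation ⟨S | R⟩ with respect to
the class 𝒞: every asymptotic homomorphism admits a sequence diminishing its defect. -/
def DefectDiminishing {S : Type} [Fintype S] (𝒰 : Ultrafilter ℕ) (𝒞 : Set MetricGroup)
    (R : Finset (FreeGroup S)) : Prop :=
  ∀ G : ℕ → MetricGroup, (∀ n, G n ∈ 𝒞) →
    ∀ φ : ∀ n, S → (G n).carrier, IsAsymptoticHom 𝒰 R G φ →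
      ∃ φ' : ∀ n, S → (G n).carrier, Diminishes 𝒰 R G φ φ'

/-- 𝒞-stability of the finitely presented group ⟨S | R⟩: for every ε > 0 there is
δ > 0 such that any φ : S → G, G ∈ 𝒞, with defect(φ) < δ has HomDist(φ) < ε. -/
def Stable {S : Type} [Fintype S] (𝒞 : Set MetricGroup) (R : Finset (FreeGroup S)) : Prop :=
  ∀ ε : ℝ, 0 < ε → ∃ δ : ℝ, 0 < δ ∧ ∀ G ∈ 𝒞, ∀ φ : S → G.carrier,
    defect R φ < δ → homDist R φ < ε

instance MetricGroup.instTopGroup (G : MetricGroup) : IsTopologicalGroup G.carrier where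
  continuous_mul := by
    have h : LipschitzWith 2 (fun p : G.carrier × G.carrier => p.1 * p.2) := by
      refine LipschitzWith.of_dist_le_mul fun p q => ?_
      have h1 := dist_triangle (p.1 * p.2) (q.1 * p.2) (q.1 * q.2)
      rw [G.dist_right_invariant, G.dist_left_invariant] at h1
      have h2 : dist p.1 q.1 ≤ dist p q := le_max_left _ _
      have h3 : dist p.2 q.2 ≤ dist p q := le_max_right _ _
      have : ((2 : NNReal) : ℝ) = 2 := rfl
      rw [this]
      linarith
    exact h.continuous
  continuous_inv := by
    have h : LipschitzWith 1 (fun p : G.carrier => p⁻¹) := by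
      refine LipschitzWith.of_dist_le_mul fun p q => ?_
      have h1 := G.dist_left_invariant p p⁻¹ q⁻¹
      have h2 := G.dist_right_invariant q (p * p⁻¹) (p * q⁻¹)
      simp only [mul_inv_cancel, one_mul, inv_mul_cancel_right] at h1 h2
      rw [← h1, ← h2, dist_comm q p]
      simp
    exact h.continuous

theorem tendsto_lift_aux {S : Type} {G : MetricGroup} (u : ℕ → S → G.carrier)
    (ψ : S → G.carrier)
    (h : ∀ s, Filter.Tendsto (fun k => u k s) Filter.atTop (nhds (ψ s))) (r : FreeGroup S) :
    Filter.Tendsto (fun k => FreeGroup.lift (u k) r) Filter.atTop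
      (nhds (FreeGroup.lift ψ r)) := by
  induction r using FreeGroup.induction_on with
  | C1 => simp
  | of s => simpa using h s
  | inv_of s _ => simpa using (h s).inv
  | mul x y hx hy => simpa using hx.mul hy

theorem dist_le_mapDist {S : Type} [Fintype S] {G : MetricGroup} (φ ψ : S → G.carrier) (s : S) :
    dist (φ s) (ψ s) ≤ mapDist φ ψ := by
  have : nndist (φ s) (ψ s) ≤ Finset.univ.sup fun s => nndist (φ s) (ψ s) :=
    Finset.le_sup (f := fun s => nndist (φ s) (ψ s)) (Finset.mem_univ s)
  exact_mod_cast this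

theorem mapDist_le {S : Type} [Fintype S] {G : MetricGroup} (φ ψ : S → G.carrier) (c : ℝ)
    (hc : 0 ≤ c) (h : ∀ s, dist (φ s) (ψ s) ≤ c) : mapDist φ ψ ≤ c := by
  lift c to NNReal using hc
  have : (Finset.univ.sup fun s => nndist (φ s) (ψ s)) ≤ c :=
    Finset.sup_le fun s _ => by exact_mod_cast h s
  exact_mod_cast this

theorem dist_le_defect {S : Type} [Fintype S] (R : Finset (FreeGroup S)) {G : MetricGroup}
    (φ : S → G.carrier) (r : FreeGroup S) (hr : r ∈ R) :
    dist (FreeGroup.lift φ r) 1 ≤ defect R φ := by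
  have : nndist (FreeGroup.lift φ r) 1 ≤ R.sup fun r => nndist ((FreeGroup.lift φ) r) 1 :=
    Finset.le_sup (f := fun r => nndist ((FreeGroup.lift φ) r) 1) hr
  exact_mod_cast this

theorem defect_nonneg' {S : Type} [Fintype S] (R : Finset (FreeGroup S)) {G : MetricGroup}
    (φ : S → G.carrier) : 0 ≤ defect R φ := NNReal.coe_nonneg _

theorem homDist_le {S : Type} [Fintype S] (R : Finset (FreeGroup S)) {G : MetricGroup}
    (φ ψ : S → G.carrier) (h : ∀ r ∈ R, FreeGroup.lift ψ r = 1) :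
    homDist R φ ≤ mapDist φ ψ := by
  have hle : Subgroup.normalClosure (R : Set (FreeGroup S)) ≤ (FreeGroup.lift ψ).ker :=
    Subgroup.normalClosure_le_normal fun r hr => h r hr
  have hb : BddBelow (Set.range fun π :
      (FreeGroup S ⧸ Subgroup.normalClosure (R : Set (FreeGroup S))) →* G.carrier =>
      mapDist φ (fun s => π ((QuotientGroup.mk' _) (FreeGroup.of s)))) :=
    ⟨0, by rintro _ ⟨π, rfl⟩; exact NNReal.coe_nonneg _⟩
  refine (ciInf_le hb (QuotientGroup.lift _ (FreeGroup.lift ψ) hle)).trans (le_of_eq ?_)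
  congr 1
  funext s
  simp

theorem uniform_diminish {S : Type} [Fintype S] (R : Finset (FreeGroup S))
    (𝒞 : Set MetricGroup)
    (𝒰 : Ultrafilter ℕ) (h𝒰 : (𝒰 : Filter ℕ) ≤ Filter.cofinite)
    (hdd : DefectDiminishing 𝒰 𝒞 R) :
    ∃ δ : ℝ, 0 < δ ∧ ∃ C : ℝ, 0 < C ∧ ∀ G ∈ 𝒞, ∀ φ : S → G.carrier, defect R φ < δ →
      ∃ φ' : S → G.carrier, mapDist φ φ' ≤ C * defect R φ ∧ defect R φ' ≤ defect R φ / 2 := by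
  by_contra hcon
  push Not at hcon
  have h1 : ∀ n : ℕ, ∃ G ∈ 𝒞, ∃ φ : S → G.carrier, defect R φ < 1 / ((n : ℝ) + 1) ∧
      ∀ φ' : S → G.carrier, mapDist φ φ' ≤ ((n : ℝ) + 1) * defect R φ →
        defect R φ / 2 < defect R φ' := fun n =>
    hcon (1 / ((n : ℝ) + 1)) (by positivity) ((n : ℝ) + 1) (by positivity)
  choose G hG φ hφ hbad using h1
  have hat : (𝒰 : Filter ℕ) ≤ Filter.atTop := by rwa [← Nat.cofinite_eq_atTop]
  have hasym : IsAsymptoticHom 𝒰 R G φ :=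
    squeeze_zero (fun n => defect_nonneg' R (φ n)) (fun n => (hφ n).le)
      (tendsto_one_div_add_atTop_nhds_zero_nat.mono_left hat)
  obtain ⟨φ', ⟨C, hC, hCU⟩, ε, hε0, hε, heq⟩ := hdd G hG φ hasym
  have e1 : ∀ᶠ n in (𝒰 : Filter ℕ), mapDist (φ n) (φ' n) ≤ C * defect R (φ n) := hCU
  have e2 : ∀ᶠ n in (𝒰 : Filter ℕ), ε n < 1 / 2 := hε.eventually_lt_const (by norm_num)
  have e3 : ∀ᶠ n : ℕ in (𝒰 : Filter ℕ), C ≤ (n : ℝ) :=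
    hat (tendsto_natCast_atTop_atTop.eventually_ge_atTop C)
  obtain ⟨n, a1, a2, a3⟩ := (e1.and (e2.and e3)).exists
  have hd := defect_nonneg' R (φ n)
  have := hbad n (φ' n) (a1.trans (mul_le_mul_of_nonneg_right (by linarith) hd))
  rw [heq n] at this
  nlinarith

/-- If Γ = ⟨S | R⟩ has the property of defect diminishing with respect to a class 𝒞
of groups with bi-invariant complete metrics, then Γ is 𝒞-stable. -/
theorem defect_diminishing_implies_stable
    {S : Type} [Fintype S] (R : Finset (FreeGroup S))
    (𝒞 : Set MetricGroup) (hcomplete : ∀ G ∈ 𝒞, CompleteSpace G.carrier)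
    (𝒰 : Ultrafilter ℕ) (h𝒰 : (𝒰 : Filter ℕ) ≤ Filter.cofinite)
    (hdd : DefectDiminishing 𝒰 𝒞 R) :
    Stable 𝒞 R := by
  obtain ⟨δ, hδ, C, hC, H⟩ := uniform_diminish R 𝒞 𝒰 h𝒰 hdd
  intro ε hε
  refine ⟨min δ (ε / (2 * C)), by positivity, ?_⟩
  intro G hG φ hφ
  have := hcomplete G hG
  have hφ1 : defect R φ < δ := hφ.trans_le (min_le_left _ _)
  have hφ2 : defect R φ < ε / (2 * C) := hφ.trans_le (min_le_right _ _)
  have H' : ∀ φ : S → G.carrier, ∃ φ' : S → G.carrier, defect R φ < δ →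
      mapDist φ φ' ≤ C * defect R φ ∧ defect R φ' ≤ defect R φ / 2 := by
    intro φ
    by_cases h : defect R φ < δ
    · obtain ⟨φ', h'⟩ := H G hG φ h
      exact ⟨φ', fun _ => h'⟩
    · exact ⟨φ, fun h' => absurd h' h⟩
  choose next hnext using H'
  let u : ℕ → S → G.carrier := fun k => next^[k] φ
  have hu : ∀ k, u (k + 1) = next (u k) := fun k => Function.iterate_succ_apply' next k φ
  have hd0 := defect_nonneg' R φ
  have hdef : ∀ k, defect R (u k) ≤ defect R φ / 2 ^ k ∧ defect R (u k) < δ := by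
    intro k
    induction k with
    | zero => simpa [u] using hφ1
    | succ k ih =>
      have h2 := (hnext (u k) ih.2).2
      have h0 := defect_nonneg' R (u k)
      rw [hu]
      refine ⟨?_, by linarith [ih.2]⟩
      rw [pow_succ, ← div_div]
      linarith [ih.1]
  have hstep : ∀ s k, dist (u k s) (u (k + 1) s) ≤ (2 * C * defect R φ) / 2 / 2 ^ k := by
    intro s k
    rw [hu]
    refine (dist_le_mapDist _ _ s).trans ((hnext (u k) (hdef k).2).1.trans ?_)
    refine (mul_le_mul_of_nonneg_left (hdef k).1 hC.le).trans (le_of_eq ?_)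
    ring
  have hlim : ∀ s, ∃ a, Filter.Tendsto (fun k => u k s) Filter.atTop (nhds a) := fun s =>
    cauchySeq_tendsto_of_complete (cauchySeq_of_le_geometric_two (hstep s))
  choose ψ hψ using hlim
  have hdist : mapDist φ ψ ≤ 2 * C * defect R φ :=
    mapDist_le _ _ _ (by positivity) fun s =>
      dist_le_of_le_geometric_two_of_tendsto₀ (hstep s) (hψ s)
  have hrel : ∀ r ∈ R, FreeGroup.lift ψ r = 1 := by
    intro r hr
    have t1 := tendsto_lift_aux u ψ hψ r
    have t2 : Filter.Tendsto (fun k => FreeGroup.lift (u k) r) Filter.atTop (nhds 1) := by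
      rw [tendsto_iff_dist_tendsto_zero]
      refine squeeze_zero (fun k => dist_nonneg)
        (fun k => (dist_le_defect R (u k) r hr).trans (hdef k).1) ?_
      have := (tendsto_pow_atTop_nhds_zero_of_lt_one (r := (1 / 2 : ℝ)) (by norm_num)
        (by norm_num)).const_mul (defect R φ)
      simpa [div_eq_mul_inv] using this
    exact tendsto_nhds_unique t1 t2
  refine (homDist_le R φ ψ hrel).trans_lt (hdist.trans_lt ?_)
  rw [lt_div_iff₀ (by positivity)] at hφ2
  linarith
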